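/- Let F be a γ-pliable set family on a finite set V, let I be an inclusion-minimal cover of F such that every edge of I covers some F-core, let L be a laminar witness family for I augmented with V, and let (S₀, S₁, …, S_ℓ) be a hollow chain in L. Let C be an F-core and let 1 ≤ i ≤ ℓ. If (C ∩ S_i) \ S₀ ≠ ∅, then C and S_i cross. -/

import Mathlib

open scoped Classical

namespace SFEC

variable {V : Type*}

/-- An edge (an unordered pair of distinct elements) `e` covers a set `S`
if exactly one endpoint of `e` lies in `S`. -/
def Covers (e : Sym2 V) (S : Set V) : Prop :=
  ∃ u v : V, e = s(u, v) ∧ u ∈ S ∧ v ∉ S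

/-- `delta I S` is the set of edges of `I` with exactly one endpoint in `S`. -/
noncomputable def delta (I : Finset (Sym2 V)) (S : Set V) : Finset (Sym2 V) :=
  I.filter (fun e => Covers e S)

/-- `d I S = |delta I S|`. -/
noncomputable def d (I : Finset (Sym2 V)) (S : Set V) : ℕ := (delta I S).card

/-- A set family on `V`: a collection of subsets with `∅ ∉ F` and `V ∉ F`. -/
def IsSetFamily (F : Set (Set V)) : Prop := ∅ ∉ F ∧ Set.univ ∉ F

/-- `I` covers the family `F` if it covers every member of `F`. -/
def CoversFam (I : Finset (Sym2 V)) (F : Set (Set V)) : Prop := ∀ S ∈ F, 1 ≤ d I S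

/-- `I` is an inclusion-minimal cover of `F`. -/
def MinimalCover (I : Finset (Sym2 V)) (F : Set (Set V)) : Prop :=
  CoversFam I F ∧ ∀ J : Finset (Sym2 V), J ⊂ I → ¬ CoversFam J F

/-- At least two of the four statements hold. -/
def AtLeastTwo (p q r s : Prop) : Prop :=
  (p ∧ q) ∨ (p ∧ r) ∨ (p ∧ s) ∨ (q ∧ r) ∨ (q ∧ s) ∨ (r ∧ s)

/-- A family is pliable if for all `A, B ∈ F` at least two of the four sets
`A ∩ B, A ∪ B, A \ B, B \ A` belong to `F`. -/
def Pliable (F : Set (Set V)) : Prop :=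
  ∀ A ∈ F, ∀ B ∈ F, AtLeastTwo (A ∩ B ∈ F) (A ∪ B ∈ F) (A \ B ∈ F) (B \ A ∈ F)

/-- The residual family `F^I`: the members of `F` covered by no edge of `I`. -/
def Residual (F : Set (Set V)) (I : Finset (Sym2 V)) : Set (Set V) := {S ∈ F | d I S = 0}

/-- `A` and `B` cross if `A ∩ B`, `A \ B`, `B \ A` and `V \ (A ∪ B)` are all nonempty. -/
def Crosses (A B : Set V) : Prop :=
  (A ∩ B).Nonempty ∧ (A \ B).Nonempty ∧ (B \ A).Nonempty ∧ ((A ∪ B)ᶜ : Set V).Nonempty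

/-- An `F`-core: an inclusion-minimal member of `F`. -/
def Core (F : Set (Set V)) (C : Set V) : Prop := C ∈ F ∧ ∀ A ∈ F, A ⊆ C → A = C

/-- Property (γ). -/
def PropertyGamma (F : Set (Set V)) : Prop :=
  ∀ (J : Finset (Sym2 V)) (S₁ S₂ C : Set V),
    S₁ ∈ Residual F J → S₂ ∈ Residual F J → S₁ ⊂ S₂ →
    Core (Residual F J) C → Crosses C S₁ → Crosses C S₂ →
    S₂ \ (S₁ ∪ C) = ∅ ∨ S₂ \ (S₁ ∪ C) ∈ Residual F J

/-- `F` is γ-pliable: pliable and satisfying Property (γ). -/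
def GammaPliable (F : Set (Set V)) : Prop := Pliable F ∧ PropertyGamma F

/-- `S` is a witness set for the edge `e ∈ I` if `δ_I(S) = {e}`. -/
def WitnessSet (F : Set (Set V)) (I : Finset (Sym2 V)) (S : Set V) (e : Sym2 V) : Prop :=
  S ∈ F ∧ delta I S = {e}

/-- `L ⊆ F` is a witness family for `I`: `|L| = |I|` and each `e ∈ I` has a witness set in `L`. -/
def WitnessFamily (F : Set (Set V)) (I : Finset (Sym2 V)) (L : Finset (Set V)) : Prop :=
  ↑L ⊆ F ∧ L.card = I.card ∧ ∀ e ∈ I, ∃ S ∈ L, WitnessSet F I S e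

/-- A family is laminar if any two members are disjoint or one contains the other. -/
def Laminar (L : Finset (Set V)) : Prop :=
  ∀ A ∈ L, ∀ B ∈ L, A ⊆ B ∨ B ⊆ A ∨ Disjoint A B

/-- `S ∈ L` owns `C` if `S` is the inclusion-minimal member of `L` containing `C`. -/
def Owns (L : Finset (Set V)) (S C : Set V) : Prop :=
  S ∈ L ∧ C ⊆ S ∧ ∀ T ∈ L, C ⊆ T → S ⊆ T

/-- `S ∈ L` is hollow if it owns no `F`-core. -/
def Hollow (F : Set (Set V)) (L : Finset (Set V)) (S : Set V) : Prop :=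
  S ∈ L ∧ ∀ C : Set V, Core F C → ¬ Owns L S C

/-- `A` is the unique child of `S` in `L`: the unique maximal member of `L`
properly contained in `S`. -/
def UniqueChild (L : Finset (Set V)) (A S : Set V) : Prop :=
  A ∈ L ∧ A ⊂ S ∧ ∀ B ∈ L, B ⊂ S → B ⊆ A

/-- `(S 0, S 1, …, S ℓ)` is a hollow chain in `L`. -/
def HollowChain (F : Set (Set V)) (L : Finset (Set V)) (S : ℕ → Set V) (ℓ : ℕ) : Prop :=
  (∀ i ≤ ℓ, S i ∈ L) ∧
  (∀ i, 1 ≤ i → i ≤ ℓ → Hollow F L (S i)) ∧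
  S ℓ ≠ Set.univ ∧
  (∀ i, 1 ≤ i → i ≤ ℓ → UniqueChild L (S (i - 1)) (S i))

/-- `U`: the union of all `F`-cores. -/
def coreUnion (F : Set (Set V)) : Set V := ⋃₀ {C | Core F C}

/-- `F` is uncrossable. -/
def Uncrossable (F : Set (Set V)) : Prop :=
  ∀ A ∈ F, ∀ B ∈ F, (A ∩ B ∈ F ∧ A ∪ B ∈ F) ∨ (A \ B ∈ F ∧ B \ A ∈ F)

/-- `F` is semi-uncrossable. -/
def SemiUncrossable (F : Set (Set V)) : Prop :=
  ∀ A ∈ F, ∀ B ∈ F,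
    (A ∩ B ∈ F ∧ (A ∪ B ∈ F ∨ A \ B ∈ F ∨ B \ A ∈ F)) ∨ (A \ B ∈ F ∧ B \ A ∈ F)

end SFEC

open SFEC

namespace SFEC

/-- In a pliable family, a core that meets a member without being contained in it crosses it. -/
theorem Core.crosses {V : Type*} {F : Set (Set V)} {C A : Set V} (hF : IsSetFamily F)
    (hp : Pliable F) (hC : Core F C) (hA : A ∈ F) (hmeet : (C ∩ A).Nonempty)
    (hsub : ¬ C ⊆ A) : Crosses C A := by
  have hinter : C ∩ A ∉ F := fun h =>
    hsub (Set.inter_eq_left.mp (hC.2 _ h Set.inter_subset_left))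
  have hdiff : C \ A ∉ F := fun h => by
    have hdisj := sdiff_eq_left.mp (hC.2 _ h Set.sdiff_subset)
    exact Set.not_disjoint_iff_nonempty_inter.mpr hmeet hdisj
  have hpq : C ∪ A ∈ F ∧ A \ C ∈ F := by
    have := hp C hC.1 A hA
    unfold AtLeastTwo at this
    tauto
  refine ⟨hmeet, Set.sdiff_nonempty.mpr hsub, ?_, ?_⟩
  · exact Set.nonempty_iff_ne_empty.mpr fun h => hF.1 (h ▸ hpq.2)
  · exact Set.nonempty_compl.mpr fun h => hF.2 (h ▸ hpq.1)

theorem Laminar.insert_univ {V : Type*} {L : Finset (Set V)} (hL : Laminar L) :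
    Laminar (insert Set.univ L) := by
  intro A hA B hB
  rcases Finset.mem_insert.mp hA with rfl | hA
  · exact Or.inr (Or.inl (Set.subset_univ B))
  rcases Finset.mem_insert.mp hB with rfl | hB
  · exact Or.inl (Set.subset_univ A)
  exact hL A hA B hB

/-- A core contained in a hollow set is contained in the unique child of that set. -/
theorem UniqueChild.core_subset {V : Type*} {F : Set (Set V)} {L : Finset (Set V)}
    {A B C : Set V} (hchild : UniqueChild L A B) (hL : Laminar L) (hB : Hollow F L B)
    (hC : Core F C) (hne : C.Nonempty) (hCB : C ⊆ B) : C ⊆ A := by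
  by_contra hCA
  refine hB.2 C hC ⟨hB.1, hCB, fun T hT hCT => ?_⟩
  by_contra hBT
  rcases hL B hB.1 T hT with h | h | h
  · exact hBT h
  · exact hCA (hCT.trans (hchild.2.2 T hT ⟨h, hBT⟩))
  · obtain ⟨x, hx⟩ := hne
    exact Set.disjoint_left.mp h (hCB hx) (hCT hx)

/-- A core contained in some set of a hollow chain is contained in its innermost set. -/
theorem HollowChain.core_subset_zero {V : Type*} {F : Set (Set V)} {L : Finset (Set V)}
    {S : ℕ → Set V} {ℓ : ℕ} {C : Set V} (h : HollowChain F L S ℓ) (hL : Laminar L)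
    (hC : Core F C) (hne : C.Nonempty) {i : ℕ} (hi : i ≤ ℓ) (hCS : C ⊆ S i) : C ⊆ S 0 := by
  induction i with
  | zero => exact hCS
  | succ k ih =>
    exact ih (by omega) ((h.2.2.2 (k + 1) (by omega) hi).core_subset hL
      (h.2.1 (k + 1) (by omega) hi) hC hne hCS)

theorem HollowChain.ne_univ {V : Type*} {F : Set (Set V)} {L : Finset (Set V)}
    {S : ℕ → Set V} {ℓ : ℕ} (h : HollowChain F L S ℓ) {i : ℕ} (hi : i ≤ ℓ) :
    S i ≠ Set.univ := by
  rcases hi.eq_or_lt with rfl | hlt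
  · exact h.2.2.1
  · have hs := (h.2.2.2 (i + 1) (by omega) hlt).2.1
    rw [Nat.add_sub_cancel] at hs
    exact (hs.trans_le (Set.subset_univ _)).ne

end SFEC

theorem stmt_9
    {V : Type*} [Fintype V]
    (F : Set (Set V)) (hF : IsSetFamily F) (hgp : GammaPliable F)
    (I : Finset (Sym2 V)) (hIe : ∀ e ∈ I, ¬ e.IsDiag)
    (hmin : MinimalCover I F)
    (hcov : ∀ e ∈ I, ∃ C : Set V, Core F C ∧ Covers e C)
    (L : Finset (Set V)) (hWF : WitnessFamily F I L) (hlam : Laminar L)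
    (S : ℕ → Set V) (ℓ : ℕ)
    (hchain : HollowChain F (insert Set.univ L) S ℓ)
    (C : Set V) (hC : Core F C)
    (i : ℕ) (hi1 : 1 ≤ i) (hiℓ : i ≤ ℓ)
    (hne : ((C ∩ S i) \ S 0).Nonempty) :
    Crosses C (S i) := by
  obtain ⟨x, ⟨hxC, hxS⟩, hx0⟩ := hne
  have hSF : S i ∈ F := hWF.1 <| Finset.mem_coe.mpr <|
    Finset.mem_of_mem_insert_of_ne (hchain.1 i hiℓ) (hchain.ne_univ hiℓ)
  exact hC.crosses hF hgp.1 hSF ⟨x, hxC, hxS⟩ fun hCS =>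
    hx0 (hchain.core_subset_zero hlam.insert_univ hC ⟨x, hxC⟩ hiℓ hCS hxC)
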